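/- arXiv:1901.02625 — 2 statements merged into one kernel-verified Lean document; each statement's English description precedes it below -/
import Mathlib

section
/- Let p be a prime, n ≥ 1, and λ ∈ ℂ with λ ≠ 0. Let V_λ be the set of ℤ_pⁿ-periodic functions f : ℚ_pⁿ → ℂ with π(pI_n)f = λ f. Then: (1) every g ∈ GL_n(ℚ_p) can be written as g = pᵏ g' with k ∈ ℤ and g' an n×n matrix over ℤ_p with det g' ≠ 0; (2) for f ∈ V_λ, the function λᵏ π(g')f is independent of the choice of such a decomposition g = pᵏ g', so π_λ(g)f := λᵏ π(g')f is well defined; (3) π_λ(g)f ∈ V_λ; and (4) π_λ(g₁g₂)f = π_λ(g₁)(π_λ(g₂)f) for all g₁, g₂ ∈ GL_n(ℚ_p) and f ∈ V_λ. -/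
open scoped BigOperators

/-- The additive subgroup `ℤ_pⁿ` of `ℚ_pⁿ`. -/
noncomputable def Zlat (p : ℕ) [Fact p.Prime] (n : ℕ) : AddSubgroup (Fin n → ℚ_[p]) :=
  AddSubgroup.pi Set.univ fun _ => (PadicInt.subring p).toAddSubgroup

/-- The finite group `g⁻¹ℤ_pⁿ/ℤ_pⁿ` inside `ℚ_pⁿ/ℤ_pⁿ`. -/
noncomputable def cosets (p : ℕ) [Fact p.Prime] (n : ℕ) (g : Matrix (Fin n) (Fin n) ℤ_[p]) :
    Set ((Fin n → ℚ_[p]) ⧸ Zlat p n) :=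
  (AddSubgroup.map (QuotientAddGroup.mk' (Zlat p n))
    (AddSubgroup.comap
      (Matrix.mulVecLin (g.map (fun a => (a : ℚ_[p])))).toAddMonoidHom (Zlat p n)) : Set _)

/-- `(π(g)f)(x) = Σ_{r ∈ g⁻¹ℤ_pⁿ/ℤ_pⁿ} f(g⁻¹x + r)`. -/
noncomputable def piOp (p : ℕ) [Fact p.Prime] (n : ℕ) (g : Matrix (Fin n) (Fin n) ℤ_[p])
    (f : (Fin n → ℚ_[p]) → ℂ) : (Fin n → ℚ_[p]) → ℂ :=
  fun x => ∑ᶠ r ∈ cosets p n g,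
    f ((g.map (fun a => (a : ℚ_[p])))⁻¹.mulVec x + Quotient.out r)

/-- `g = pᵏ g'` with `g'` an integral matrix with nonzero determinant. -/
def IsDecomp (p : ℕ) [Fact p.Prime] (n : ℕ) (g : Matrix (Fin n) (Fin n) ℚ_[p]) (k : ℤ)
    (g' : Matrix (Fin n) (Fin n) ℤ_[p]) : Prop :=
  g'.det ≠ 0 ∧ g = ((p : ℚ_[p]) ^ k) • g'.map (fun a => (a : ℚ_[p]))

/-- Membership in `V_λ`: `f` is `ℤ_pⁿ`-periodic and `π(pI_n) f = λ f`. -/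
noncomputable def MemV (p : ℕ) [Fact p.Prime] (n : ℕ) (lam : ℂ)
    (f : (Fin n → ℚ_[p]) → ℂ) : Prop :=
  (∀ x r, r ∈ Zlat p n → f (x + r) = f x) ∧
    piOp p n ((p : ℤ_[p]) • (1 : Matrix (Fin n) (Fin n) ℤ_[p])) f = fun x => lam * f x

section LatticeOperators

variable {p : ℕ} [Fact p.Prime] {n : ℕ}

/-- The matrix over `ℚ_p` underlying a matrix over `ℤ_p`. -/
local notation "toQ" g => Matrix.map g (fun a : ℤ_[p] => (a : ℚ_[p]))

theorem mem_Zlat {x : Fin n → ℚ_[p]} : x ∈ Zlat p n ↔ ∀ i, ‖x i‖ ≤ 1 := by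
  simp [Zlat, AddSubgroup.mem_pi, PadicInt.subring]

theorem exists_padicInt_coe_eq {x : ℚ_[p]} (hx : ‖x‖ ≤ 1) : ∃ z : ℤ_[p], (z : ℚ_[p]) = x :=
  ⟨⟨x, hx⟩, rfl⟩

theorem mulVec_mem_Zlat (g : Matrix (Fin n) (Fin n) ℤ_[p]) {x : Fin n → ℚ_[p]}
    (hx : x ∈ Zlat p n) : (toQ g).mulVec x ∈ Zlat p n := by
  choose y hy using fun j => exists_padicInt_coe_eq (mem_Zlat.1 hx j)
  have : (toQ g).mulVec x = fun i => (g.mulVec y i : ℚ_[p]) := by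
    ext i
    simp [Matrix.mulVec, dotProduct, ← hy]
  rw [this, mem_Zlat]
  exact fun i => PadicInt.norm_le_one _

theorem map_mul_toQ (g h : Matrix (Fin n) (Fin n) ℤ_[p]) :
    (toQ (g * h)) = (toQ g) * (toQ h) :=
  Matrix.map_mul (f := PadicInt.Coe.ringHom (p := p))

theorem det_toQ (g : Matrix (Fin n) (Fin n) ℤ_[p]) : (toQ g).det = (g.det : ℚ_[p]) :=
  (RingHom.map_det (PadicInt.Coe.ringHom (p := p)) g).symm

theorem isUnit_det_toQ {g : Matrix (Fin n) (Fin n) ℤ_[p]} (hg : g.det ≠ 0) :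
    IsUnit (toQ g).det := by
  rw [det_toQ, isUnit_iff_ne_zero]
  exact PadicInt.coe_ne_zero.2 hg

/-- The endomorphism of `ℚ_pⁿ/ℤ_pⁿ` induced by an integral matrix. -/
noncomputable def latticeMap (g : Matrix (Fin n) (Fin n) ℤ_[p]) :
    ((Fin n → ℚ_[p]) ⧸ Zlat p n) →+ ((Fin n → ℚ_[p]) ⧸ Zlat p n) :=
  QuotientAddGroup.map _ _ (Matrix.mulVecLin (toQ g)).toAddMonoidHom
    fun _ hx => mulVec_mem_Zlat g hx

theorem latticeMap_mk (g : Matrix (Fin n) (Fin n) ℤ_[p]) (x : Fin n → ℚ_[p]) :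
    latticeMap g (x : (Fin n → ℚ_[p]) ⧸ Zlat p n) = (((toQ g).mulVec x : Fin n → ℚ_[p]) :
      (Fin n → ℚ_[p]) ⧸ Zlat p n) := rfl

theorem latticeMap_mul (g h : Matrix (Fin n) (Fin n) ℤ_[p])
    (q : (Fin n → ℚ_[p]) ⧸ Zlat p n) : latticeMap (g * h) q = latticeMap g (latticeMap h q) := by
  induction q using QuotientAddGroup.induction_on with
  | H x => rw [latticeMap_mk, latticeMap_mk, latticeMap_mk, map_mul_toQ, Matrix.mulVec_mulVec]

theorem mem_cosets {g : Matrix (Fin n) (Fin n) ℤ_[p]} {q : (Fin n → ℚ_[p]) ⧸ Zlat p n} :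
    q ∈ cosets p n g ↔ latticeMap g q = 0 := by
  constructor
  · rintro ⟨x, hx, rfl⟩
    exact (QuotientAddGroup.eq_zero_iff _).2 hx
  · induction q using QuotientAddGroup.induction_on with
    | H x => exact fun h => ⟨x, (QuotientAddGroup.eq_zero_iff ((toQ g).mulVec x)).1 h, rfl⟩

theorem finite_cosets {g : Matrix (Fin n) (Fin n) ℤ_[p]} (hg : g.det ≠ 0) :
    (cosets p n g).Finite := by
  set m := g.det.valuation
  have hp : (p : ℚ_[p]) ≠ 0 := by exact_mod_cast (Fact.out : p.Prime).ne_zero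
  have hdet : ((g.det : ℤ_[p]) : ℚ_[p]) =
      ((PadicInt.unitCoeff hg : ℤ_[p]) : ℚ_[p]) * (p : ℚ_[p]) ^ m := by
    conv_lhs => rw [PadicInt.unitCoeff_spec hg]
    push_cast
    rfl
  refine (Set.finite_range fun v : Fin n → Fin (p ^ m) =>
    ((fun i => ((v i : ℕ) : ℚ_[p]) / (p : ℚ_[p]) ^ m : Fin n → ℚ_[p]) :
      (Fin n → ℚ_[p]) ⧸ Zlat p n)).subset ?_
  rintro _ ⟨x, hx, rfl⟩
  have hx' : (toQ g).mulVec x ∈ Zlat p n := hx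
  have hadj : ∀ i, ‖(p : ℚ_[p]) ^ m * x i‖ ≤ 1 := by
    intro i
    have h := mem_Zlat.1 (mulVec_mem_Zlat g.adjugate hx') i
    have hdiag : (toQ (g.det • (1 : Matrix (Fin n) (Fin n) ℤ_[p]))) =
        (g.det : ℚ_[p]) • (1 : Matrix (Fin n) (Fin n) ℚ_[p]) := by
      ext i j
      by_cases hij : i = j <;> simp [hij]
    rwa [Matrix.mulVec_mulVec, ← map_mul_toQ, Matrix.adjugate_mul, hdiag, Matrix.smul_mulVec,
      Matrix.one_mulVec, Pi.smul_apply, smul_eq_mul, hdet, mul_assoc, norm_mul,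
      show ‖((PadicInt.unitCoeff hg : ℤ_[p]) : ℚ_[p])‖ = 1 from PadicInt.norm_units _,
      one_mul] at h
  choose y hy using fun i => exists_padicInt_coe_eq (hadj i)
  refine ⟨fun i => ⟨(y i).appr m, PadicInt.appr_lt _ _⟩, ?_⟩
  refine QuotientAddGroup.eq.2 (mem_Zlat.2 fun i => ?_)
  obtain ⟨c, hc⟩ := Ideal.mem_span_singleton'.1 (PadicInt.appr_spec m (y i))
  have hc' := congrArg (fun z : ℤ_[p] => (z : ℚ_[p])) hc
  push_cast at hc'
  rw [hy] at hc'
  have : (-(fun i => (((y i).appr m : ℕ) : ℚ_[p]) / (p : ℚ_[p]) ^ m) + x) i = (c : ℚ_[p]) := by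
    simp only [Pi.add_apply, Pi.neg_apply]
    field_simp
    linear_combination -hc'
  exact this ▸ PadicInt.norm_le_one c

theorem finite_fiber {g : Matrix (Fin n) (Fin n) ℤ_[p]} (hg : g.det ≠ 0)
    (y : (Fin n → ℚ_[p]) ⧸ Zlat p n) : {q | latticeMap g q = y}.Finite := by
  rcases Set.eq_empty_or_nonempty {q | latticeMap g q = y} with h | ⟨q₀, hq₀⟩
  · simp [h]
  · refine ((finite_cosets hg).image (q₀ + ·)).subset fun q hq => ⟨q - q₀, ?_, by simp⟩
    rw [mem_cosets, map_sub, hq, hq₀, sub_self]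

theorem periodic_out {f : (Fin n → ℚ_[p]) → ℂ} (hf : ∀ x r, r ∈ Zlat p n → f (x + r) = f x)
    {x y : Fin n → ℚ_[p]} (h : (x : (Fin n → ℚ_[p]) ⧸ Zlat p n) = y) : f x = f y := by
  simpa using (hf x _ (QuotientAddGroup.eq.1 h)).symm

/-- `π(g)f` is the sum of `f` over the fibre of `g` on `ℚ_pⁿ/ℤ_pⁿ`. -/
theorem piOp_eq_fiber_sum {g : Matrix (Fin n) (Fin n) ℤ_[p]} (hg : g.det ≠ 0)
    {f : (Fin n → ℚ_[p]) → ℂ} (hf : ∀ x r, r ∈ Zlat p n → f (x + r) = f x)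
    (x : Fin n → ℚ_[p]) :
    piOp p n g f x =
      ∑ᶠ q ∈ {q | latticeMap g q = (x : (Fin n → ℚ_[p]) ⧸ Zlat p n)}, f (Quotient.out q) := by
  have hx : latticeMap g (((toQ g)⁻¹.mulVec x : Fin n → ℚ_[p]) : (Fin n → ℚ_[p]) ⧸ Zlat p n)
      = (x : (Fin n → ℚ_[p]) ⧸ Zlat p n) := by
    rw [latticeMap_mk, Matrix.mulVec_mulVec, Matrix.mul_nonsing_inv _ (isUnit_det_toQ hg),
      Matrix.one_mulVec]
  refine finsum_mem_eq_of_bijOn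
    ((((toQ g)⁻¹.mulVec x : Fin n → ℚ_[p]) : (Fin n → ℚ_[p]) ⧸ Zlat p n) + ·)
    ⟨?_, fun _ _ _ _ h => add_left_cancel h, ?_⟩ ?_
  · intro q hq
    simp [hx, mem_cosets.1 hq]
  · intro q hq
    refine ⟨q - (((toQ g)⁻¹.mulVec x : Fin n → ℚ_[p]) : (Fin n → ℚ_[p]) ⧸ Zlat p n), ?_, by simp⟩
    rw [mem_cosets, map_sub, hx, hq, sub_self]
  · intro q _
    refine periodic_out hf ?_
    rw [QuotientAddGroup.mk_add, QuotientAddGroup.out_eq', QuotientAddGroup.out_eq']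

theorem piOp_periodic {g : Matrix (Fin n) (Fin n) ℤ_[p]} (hg : g.det ≠ 0)
    {f : (Fin n → ℚ_[p]) → ℂ} (hf : ∀ x r, r ∈ Zlat p n → f (x + r) = f x)
    (x r : Fin n → ℚ_[p]) (hr : r ∈ Zlat p n) : piOp p n g f (x + r) = piOp p n g f x := by
  rw [piOp_eq_fiber_sum hg hf, piOp_eq_fiber_sum hg hf, QuotientAddGroup.mk_add_of_mem x hr]

theorem piOp_const_mul (g : Matrix (Fin n) (Fin n) ℤ_[p]) (c : ℂ) (f : (Fin n → ℚ_[p]) → ℂ) :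
    piOp p n g (fun x => c * f x) = fun x => c * piOp p n g f x := by
  ext x
  exact (mul_finsum_mem _ _).symm

theorem piOp_mul {g h : Matrix (Fin n) (Fin n) ℤ_[p]} (hg : g.det ≠ 0) (hh : h.det ≠ 0)
    {f : (Fin n → ℚ_[p]) → ℂ} (hf : ∀ x r, r ∈ Zlat p n → f (x + r) = f x) :
    piOp p n (g * h) f = piOp p n g (piOp p n h f) := by
  ext x
  have hgh : (g * h).det ≠ 0 := by rw [Matrix.det_mul]; exact mul_ne_zero hg hh
  have hset : {q | latticeMap (g * h) q = (x : (Fin n → ℚ_[p]) ⧸ Zlat p n)} =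
      ⋃ q' ∈ {q | latticeMap g q = (x : (Fin n → ℚ_[p]) ⧸ Zlat p n)},
        {q | latticeMap h q = q'} := by
    ext q
    simp [latticeMap_mul]
  rw [piOp_eq_fiber_sum hgh hf, piOp_eq_fiber_sum hg (piOp_periodic hh hf), hset,
    finsum_mem_biUnion _ (finite_fiber hg _) fun q' _ => finite_fiber hh q']
  · refine finsum_mem_congr rfl fun q' _ => ?_
    rw [piOp_eq_fiber_sum hh hf, QuotientAddGroup.out_eq']
  · intro a _ b _ hab
    exact Set.disjoint_left.2 fun q hqa hqb => hab (hqa.symm.trans hqb)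

theorem det_p_smul_one_ne_zero :
    ((p : ℤ_[p]) • (1 : Matrix (Fin n) (Fin n) ℤ_[p])).det ≠ 0 := by
  rw [Matrix.det_smul, Matrix.det_one, mul_one]
  exact pow_ne_zero _ (by exact_mod_cast (Fact.out : p.Prime).ne_zero)

theorem det_pow_smul_ne_zero {g : Matrix (Fin n) (Fin n) ℤ_[p]} (hg : g.det ≠ 0) (a : ℕ) :
    ((p : ℤ_[p]) ^ a • g).det ≠ 0 := by
  rw [Matrix.det_smul]
  exact mul_ne_zero (pow_ne_zero _ (pow_ne_zero _
    (by exact_mod_cast (Fact.out : p.Prime).ne_zero))) hg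

theorem piOp_pow_smul {lam : ℂ} {g : Matrix (Fin n) (Fin n) ℤ_[p]} (hg : g.det ≠ 0)
    {f : (Fin n → ℚ_[p]) → ℂ} (hf : MemV p n lam f) (a : ℕ) :
    piOp p n ((p : ℤ_[p]) ^ a • g) f = fun x => lam ^ a * piOp p n g f x := by
  induction a with
  | zero => simp
  | succ a ih =>
    have : (p : ℤ_[p]) ^ (a + 1) • g =
        ((p : ℤ_[p]) ^ a • g) * ((p : ℤ_[p]) • (1 : Matrix (Fin n) (Fin n) ℤ_[p])) := by
      rw [Matrix.mul_smul, mul_one, smul_smul, pow_succ']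
    rw [this, piOp_mul (det_pow_smul_ne_zero hg a) det_p_smul_one_ne_zero hf.1, hf.2,
      piOp_const_mul, ih]
    ext x
    ring

theorem MemV.const_mul_piOp {lam : ℂ} {g : Matrix (Fin n) (Fin n) ℤ_[p]} (hg : g.det ≠ 0)
    {f : (Fin n → ℚ_[p]) → ℂ} (hf : MemV p n lam f) (c : ℂ) :
    MemV p n lam (fun x => c * piOp p n g f x) := by
  refine ⟨fun x r hr => congrArg (c * ·) (piOp_periodic hg hf.1 x r hr), ?_⟩
  rw [piOp_const_mul, ← piOp_mul det_p_smul_one_ne_zero hg hf.1,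
    Matrix.smul_mul, one_mul]
  have := piOp_pow_smul hg hf 1
  rw [pow_one, pow_one] at this
  rw [this]
  ext x
  ring

theorem exists_isDecomp {g : Matrix (Fin n) (Fin n) ℚ_[p]} (hg : g.det ≠ 0) :
    ∃ (k : ℤ) (g' : Matrix (Fin n) (Fin n) ℤ_[p]), IsDecomp p n g k g' := by
  have hp1 : (1 : ℝ) < p := by exact_mod_cast (Fact.out : p.Prime).one_lt
  have hp : (p : ℚ_[p]) ≠ 0 := by exact_mod_cast (Fact.out : p.Prime).ne_zero
  obtain ⟨N, hN⟩ := pow_unbounded_of_one_lt (∑ i, ∑ j, ‖g i j‖) hp1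
  have hint : ∀ i j, ‖(p : ℚ_[p]) ^ N * g i j‖ ≤ 1 := by
    intro i j
    have h1 : ‖g i j‖ ≤ (p : ℝ) ^ N := by
      refine le_trans ?_ hN.le
      refine (Finset.single_le_sum (f := fun j => ‖g i j‖) (fun _ _ => norm_nonneg _)
        (Finset.mem_univ j)).trans ?_
      exact Finset.single_le_sum (f := fun i => ∑ j, ‖g i j‖)
        (fun _ _ => Finset.sum_nonneg fun _ _ => norm_nonneg _) (Finset.mem_univ i)
    rw [norm_mul, norm_pow, Padic.norm_p, inv_pow, inv_mul_le_one₀ (by positivity)]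
    exact h1
  choose g' hg' using fun i j => exists_padicInt_coe_eq (hint i j)
  have hdec : g = ((p : ℚ_[p]) ^ (-(N : ℤ))) • (toQ (Matrix.of g')) := by
    ext i j
    simp [hg', hp]
  refine ⟨-N, _, fun h0 => hg ?_, hdec⟩
  rw [hdec, Matrix.det_smul, det_toQ, h0, PadicInt.coe_zero, mul_zero]

theorem isDecomp_unique_of_le {lam : ℂ} (hlam : lam ≠ 0) {g : Matrix (Fin n) (Fin n) ℚ_[p]}
    {k₁ k₂ : ℤ} (hk : k₁ ≤ k₂) {g₁ g₂ : Matrix (Fin n) (Fin n) ℤ_[p]}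
    (h₁ : IsDecomp p n g k₁ g₁) (h₂ : IsDecomp p n g k₂ g₂)
    {f : (Fin n → ℚ_[p]) → ℂ} (hf : MemV p n lam f) :
    (fun x => lam ^ k₁ * piOp p n g₁ f x) = fun x => lam ^ k₂ * piOp p n g₂ f x := by
  have hp : (p : ℚ_[p]) ≠ 0 := by exact_mod_cast (Fact.out : p.Prime).ne_zero
  obtain ⟨a, rfl⟩ := Int.le.dest hk
  have hg : g₁ = (p : ℤ_[p]) ^ a • g₂ := by
    ext i j
    have h := congrFun (congrFun (h₁.2.symm.trans h₂.2) i) j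
    simp only [Matrix.smul_apply, Matrix.map_apply, smul_eq_mul, zpow_add₀ hp, zpow_natCast,
      mul_assoc] at h
    exact PadicInt.ext (by simpa using mul_left_cancel₀ (zpow_ne_zero _ hp) h)
  rw [hg, piOp_pow_smul h₂.1 hf]
  ext x
  rw [zpow_add₀ hlam, zpow_natCast, mul_assoc]

theorem isDecomp_unique {lam : ℂ} (hlam : lam ≠ 0) {g : Matrix (Fin n) (Fin n) ℚ_[p]}
    {k₁ k₂ : ℤ} {g₁ g₂ : Matrix (Fin n) (Fin n) ℤ_[p]}
    (h₁ : IsDecomp p n g k₁ g₁) (h₂ : IsDecomp p n g k₂ g₂)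
    {f : (Fin n → ℚ_[p]) → ℂ} (hf : MemV p n lam f) :
    (fun x => lam ^ k₁ * piOp p n g₁ f x) = fun x => lam ^ k₂ * piOp p n g₂ f x := by
  rcases le_total k₁ k₂ with h | h
  · exact isDecomp_unique_of_le hlam h h₁ h₂ hf
  · exact (isDecomp_unique_of_le hlam h h₂ h₁ hf).symm

theorem IsDecomp.mul {g h : Matrix (Fin n) (Fin n) ℚ_[p]} {k l : ℤ}
    {g' h' : Matrix (Fin n) (Fin n) ℤ_[p]} (hg : IsDecomp p n g k g') (hh : IsDecomp p n h l h') :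
    IsDecomp p n (g * h) (k + l) (g' * h') := by
  have hp : (p : ℚ_[p]) ≠ 0 := by exact_mod_cast (Fact.out : p.Prime).ne_zero
  refine ⟨by rw [Matrix.det_mul]; exact mul_ne_zero hg.1 hh.1, ?_⟩
  rw [map_mul_toQ, hg.2, hh.2, Matrix.smul_mul, Matrix.mul_smul, smul_smul, zpow_add₀ hp]

end LatticeOperators

theorem padic_GLn_representation (p : ℕ) [Fact p.Prime] (n : ℕ) (hn : 1 ≤ n)
    (lam : ℂ) (hlam : lam ≠ 0) :
    -- (1) existence of decompositions
    (∀ g : Matrix (Fin n) (Fin n) ℚ_[p], g.det ≠ 0 →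
      ∃ (k : ℤ) (g' : Matrix (Fin n) (Fin n) ℤ_[p]), IsDecomp p n g k g') ∧
    -- (2) independence of the decomposition
    (∀ (g : Matrix (Fin n) (Fin n) ℚ_[p]) (k₁ k₂ : ℤ)
        (g₁' g₂' : Matrix (Fin n) (Fin n) ℤ_[p]),
      IsDecomp p n g k₁ g₁' → IsDecomp p n g k₂ g₂' →
      ∀ f, MemV p n lam f →
        (fun x => lam ^ k₁ * piOp p n g₁' f x) = (fun x => lam ^ k₂ * piOp p n g₂' f x)) ∧
    -- (3) `π_λ(g) f ∈ V_λ`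
    (∀ (g : Matrix (Fin n) (Fin n) ℚ_[p]) (k : ℤ) (g' : Matrix (Fin n) (Fin n) ℤ_[p]),
      IsDecomp p n g k g' →
      ∀ f, MemV p n lam f → MemV p n lam (fun x => lam ^ k * piOp p n g' f x)) ∧
    -- (4) `π_λ(g₁ g₂) f = π_λ(g₁) (π_λ(g₂) f)`
    (∀ (g₁ g₂ : Matrix (Fin n) (Fin n) ℚ_[p]), g₁.det ≠ 0 → g₂.det ≠ 0 →
      ∀ (k₁ k₂ k₁₂ : ℤ) (g₁' g₂' g₁₂' : Matrix (Fin n) (Fin n) ℤ_[p]),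
      IsDecomp p n g₁ k₁ g₁' → IsDecomp p n g₂ k₂ g₂' → IsDecomp p n (g₁ * g₂) k₁₂ g₁₂' →
      ∀ f, MemV p n lam f →
        (fun x => lam ^ k₁₂ * piOp p n g₁₂' f x)
          = (fun x => lam ^ k₁ * piOp p n g₁' (fun y => lam ^ k₂ * piOp p n g₂' f y) x)) := by
  refine ⟨fun g hg => exists_isDecomp hg, fun g k₁ k₂ g₁' g₂' h₁ h₂ f hf =>
    isDecomp_unique hlam h₁ h₂ hf, fun g k g' h f hf => hf.const_mul_piOp h.1 _, ?_⟩
  intro g₁ g₂ _ _ k₁ k₂ k₁₂ g₁' g₂' g₁₂' h₁ h₂ h₁₂ f hf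
  rw [isDecomp_unique hlam h₁₂ (h₁.mul h₂) hf, piOp_mul h₁.1 h₂.1 hf.1,
    piOp_const_mul]
  ext x
  rw [zpow_add₀ hlam, mul_assoc]
end

section
/- Let d₁, d₂, v₁, v₂, z ∈ ℝ and let v be the lower triangular unipotent 3×3 real matrix with rows (1, 0, 0), (v₁, 1, 0), (z, v₂, 1). Then for every Schwartz function f on the space M₃(ℝ) of 3×3 real matrices, ∫_{ℝ⁸} f(X vᵀ) e^{2πi(d₁ x₂₂/x₂₁ + d₂ x₃₃/x₃₂)} dX = e^{-2πi(d₁v₁ + d₂v₂)} ∫_{ℝ⁸} f(X) e^{2πi(d₁ x₂₂/x₂₁ + d₂ x₃₃/x₃₂)} dX, where X runs over the 3×3 real matrices with entry x₃₁ = 0, and dX is Lebesgue measure in the remaining eight entries (both integrands are absolutely integrable, the phase being defined off the null set where x₂₁ = 0 or x₃₂ = 0). -/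
open MeasureTheory Matrix

/-- The 3×3 matrix with `x₃₁ = 0` built from the eight free coordinates
`x₁₁, x₁₂, x₁₃, x₂₁, x₂₂, x₂₃, x₃₂, x₃₃`. -/
def Xof (y : Fin 8 → ℝ) : Matrix (Fin 3) (Fin 3) ℝ :=
  !![y 0, y 1, y 2; y 3, y 4, y 5; 0, y 6, y 7]

/-- The phase `e^{2πi(d₁ x₂₂/x₂₁ + d₂ x₃₃/x₃₂)}`. -/
noncomputable def phase14 (d₁ d₂ : ℝ) (y : Fin 8 → ℝ) : ℂ :=
  Complex.exp (2 * Real.pi * Complex.I * ((d₁ : ℂ) * ((y 4 : ℝ) / y 3 : ℝ)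
    + (d₂ : ℂ) * ((y 7 : ℝ) / y 6 : ℝ)))

/-- The linear embedding of the eight free coordinates into the 3×3 matrices. -/
noncomputable def coordEmbedding : (Fin 8 → ℝ) →L[ℝ] (Fin 3 → Fin 3 → ℝ) :=
  LinearMap.toContinuousLinearMap
    { toFun := fun y i j => Xof y i j
      map_add' := by
        intro x y
        ext i j
        fin_cases i <;> fin_cases j <;> simp [Xof]
      map_smul' := by
        intro c y
        ext i j
        fin_cases i <;> fin_cases j <;> simp [Xof] }

theorem coordEmbedding_apply (y : Fin 8 → ℝ) : coordEmbedding y = fun i j => Xof y i j := rfl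

theorem norm_le_norm_coordEmbedding (y : Fin 8 → ℝ) : ‖y‖ ≤ ‖coordEmbedding y‖ := by
  have entry (i j : Fin 3) : ‖Xof y i j‖ ≤ ‖coordEmbedding y‖ :=
    (norm_le_pi_norm (coordEmbedding y i) j).trans (norm_le_pi_norm (coordEmbedding y) i)
  refine (pi_norm_le_iff_of_nonneg (norm_nonneg _)).2 fun i => ?_
  fin_cases i
  · exact entry 0 0
  · exact entry 0 1
  · exact entry 0 2
  · exact entry 1 0
  · exact entry 1 1
  · exact entry 1 2
  · exact entry 2 1
  · exact entry 2 2

theorem norm_phase14 (d₁ d₂ : ℝ) (y : Fin 8 → ℝ) : ‖phase14 d₁ d₂ y‖ = 1 := by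
  have h : phase14 d₁ d₂ y = Complex.exp
      (((2 * Real.pi * (d₁ * (y 4 / y 3) + d₂ * (y 7 / y 6)) : ℝ) : ℂ) * Complex.I) := by
    rw [phase14]
    congr 1
    push_cast
    ring
  rw [h, Complex.norm_exp_ofReal_mul_I]

theorem measurable_phase14 (d₁ d₂ : ℝ) : Measurable (phase14 d₁ d₂) := by
  unfold phase14
  fun_prop

theorem integrable_schwartz_mul_phase14 (d₁ d₂ : ℝ)
    (f : SchwartzMap (Fin 3 → Fin 3 → ℝ) ℂ) :
    Integrable (fun y : Fin 8 → ℝ => f (fun i j => Xof y i j) * phase14 d₁ d₂ y) := by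
  have anti : AntilipschitzWith 1 coordEmbedding :=
    ContinuousLinearMap.antilipschitz_of_bound _ fun y => by
      simpa using norm_le_norm_coordEmbedding y
  have h : Integrable (fun y : Fin 8 → ℝ => f (fun i j => Xof y i j)) :=
    (SchwartzMap.compCLMOfAntilipschitz ℝ
      coordEmbedding.hasTemperateGrowth anti f).integrable
  exact h.mul_bdd (measurable_phase14 d₁ d₂).aestronglyMeasurable
    (Filter.Eventually.of_forall fun y => (norm_phase14 d₁ d₂ y).le)

/-- The matrix of right multiplication by the transposed unipotent in the eight coordinates. -/
def unipotentAction (v₁ v₂ z : ℝ) : Matrix (Fin 8) (Fin 8) ℝ :=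
  !![1, 0, 0, 0, 0, 0, 0, 0;
     v₁, 1, 0, 0, 0, 0, 0, 0;
     z, v₂, 1, 0, 0, 0, 0, 0;
     0, 0, 0, 1, 0, 0, 0, 0;
     0, 0, 0, v₁, 1, 0, 0, 0;
     0, 0, 0, z, v₂, 1, 0, 0;
     0, 0, 0, 0, 0, 0, 1, 0;
     0, 0, 0, 0, 0, 0, v₂, 1]

theorem det_unipotentAction (v₁ v₂ z : ℝ) : (unipotentAction v₁ v₂ z).det = 1 := by
  rw [Matrix.det_of_isLowerTriangular]
  · simp [unipotentAction, Fin.prod_univ_succ]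
  · intro i j hij
    replace hij : i < j := hij
    fin_cases i <;> fin_cases j <;> first | rfl | exact absurd hij (by decide)

theorem Xof_unipotentAction_mulVec (v₁ v₂ z : ℝ) (y : Fin 8 → ℝ) :
    Xof (unipotentAction v₁ v₂ z *ᵥ y) =
      Xof y * (!![1, 0, 0; v₁, 1, 0; z, v₂, 1] : Matrix (Fin 3) (Fin 3) ℝ)ᵀ := by
  ext i j
  fin_cases i <;> fin_cases j <;>
    simp [Xof, unipotentAction, Matrix.mulVec, dotProduct, Matrix.mul_apply,
      Fin.sum_univ_succ] <;> ring

theorem measurePreserving_unipotentAction (v₁ v₂ z : ℝ) :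
    MeasurePreserving (fun y : Fin 8 → ℝ => unipotentAction v₁ v₂ z *ᵥ y) := by
  refine ⟨(Continuous.matrix_mulVec continuous_const continuous_id).measurable, ?_⟩
  have h := Real.map_matrix_volume_pi_eq_smul_volume_pi (M := unipotentAction v₁ v₂ z)
    (by simp [det_unipotentAction])
  rw [det_unipotentAction, inv_one, abs_one, ENNReal.ofReal_one, one_smul] at h
  exact h

theorem phase14_unipotentAction_mulVec (d₁ d₂ v₁ v₂ z : ℝ) {y : Fin 8 → ℝ}
    (h₃ : y 3 ≠ 0) (h₆ : y 6 ≠ 0) :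
    phase14 d₁ d₂ y =
      Complex.exp (-(2 * Real.pi * Complex.I) * ((d₁ : ℂ) * v₁ + (d₂ : ℂ) * v₂)) *
        phase14 d₁ d₂ (unipotentAction v₁ v₂ z *ᵥ y) := by
  have e := Xof_unipotentAction_mulVec v₁ v₂ z y
  have e₃ : (unipotentAction v₁ v₂ z *ᵥ y) 3 = y 3 := by
    simpa [Xof, Matrix.mul_apply, Fin.sum_univ_succ] using congrFun₂ e 1 0
  have e₄ : (unipotentAction v₁ v₂ z *ᵥ y) 4 = y 3 * v₁ + y 4 := by
    simpa [Xof, Matrix.mul_apply, Fin.sum_univ_succ] using congrFun₂ e 1 1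
  have e₆ : (unipotentAction v₁ v₂ z *ᵥ y) 6 = y 6 := by
    simpa [Xof, Matrix.mul_apply, Fin.sum_univ_succ] using congrFun₂ e 2 1
  have e₇ : (unipotentAction v₁ v₂ z *ᵥ y) 7 = y 6 * v₂ + y 7 := by
    simpa [Xof, Matrix.mul_apply, Fin.sum_univ_succ] using congrFun₂ e 2 2
  rw [phase14, phase14, ← Complex.exp_add, e₃, e₄, e₆, e₇, add_div, add_div,
    mul_div_cancel_left₀ _ h₃, mul_div_cancel_left₀ _ h₆]
  congr 1
  push_cast
  ring

theorem whittaker_functional_GL3_right (d₁ d₂ v₁ v₂ z : ℝ)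
    (f : SchwartzMap (Fin 3 → Fin 3 → ℝ) ℂ) :
    Integrable (fun y : Fin 8 → ℝ =>
      f (fun i j => (Xof y *
        (!![1, 0, 0; v₁, 1, 0; z, v₂, 1] : Matrix (Fin 3) (Fin 3) ℝ)ᵀ) i j)
        * phase14 d₁ d₂ y) ∧
    Integrable (fun y : Fin 8 → ℝ => f (fun i j => Xof y i j) * phase14 d₁ d₂ y) ∧
    (∫ y : Fin 8 → ℝ,
        f (fun i j => (Xof y *
          (!![1, 0, 0; v₁, 1, 0; z, v₂, 1] : Matrix (Fin 3) (Fin 3) ℝ)ᵀ) i j)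
          * phase14 d₁ d₂ y)
      = Complex.exp (-(2 * Real.pi * Complex.I) * ((d₁ : ℂ) * v₁ + (d₂ : ℂ) * v₂))
          * ∫ y : Fin 8 → ℝ, f (fun i j => Xof y i j) * phase14 d₁ d₂ y := by
  have hF := integrable_schwartz_mul_phase14 d₁ d₂ f
  have hT := measurePreserving_unipotentAction v₁ v₂ z
  have ne (i : Fin 8) : ∀ᵐ y : Fin 8 → ℝ, y i ≠ 0 :=
    Measure.ae_eval_ne (μ := fun _ : Fin 8 => (volume : Measure ℝ)) i 0
  have hG : (fun y : Fin 8 → ℝ =>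
      f (fun i j => (Xof y *
        (!![1, 0, 0; v₁, 1, 0; z, v₂, 1] : Matrix (Fin 3) (Fin 3) ℝ)ᵀ) i j)
        * phase14 d₁ d₂ y) =ᵐ[volume] fun y =>
      Complex.exp (-(2 * Real.pi * Complex.I) * ((d₁ : ℂ) * v₁ + (d₂ : ℂ) * v₂)) *
        (f (fun i j => Xof (unipotentAction v₁ v₂ z *ᵥ y) i j) *
          phase14 d₁ d₂ (unipotentAction v₁ v₂ z *ᵥ y)) := by
    filter_upwards [ne 3, ne 6] with y h₃ h₆
    rw [phase14_unipotentAction_mulVec d₁ d₂ v₁ v₂ z h₃ h₆, Xof_unipotentAction_mulVec]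
    ring
  refine ⟨((hT.integrable_comp_of_integrable hF).const_mul _).congr hG.symm, hF, ?_⟩
  rw [integral_congr_ae hG, integral_const_mul]
  congr 1
  have h := integral_map hT.aemeasurable (hT.map_eq.symm ▸ hF.aestronglyMeasurable)
  rw [hT.map_eq] at h
  exact h.symm
end
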